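/- Let M = M(S,C) be a configuration category in which every C(α) has enough injectives, and let U ⊆ S be open with closed complement Z = S − U. Then the exact functors i_*: D^b(M(Z,C|_Z)) → D^b(M) and j_!: D^b(M(U,C|_U)) → D^b(M) between bounded derived categories are fully faithful, and their essential images are respectively the full subcategories D_Z^b(M) and D_U^b(M) of complexes whose cohomology objects are supported in Z, respectively in U. -/

import Mathlib

open CategoryTheory CategoryTheory.Limits

universe w v u

/-- A diagram of categories indexed by a poset `S`: for `β ≤ α`, a transition functor
`φ : C α ⥤ C β`, strictly functorial. -/
structure PosetDiagram (S : Type) [PartialOrder S] where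
  C : S → Type u
  cat : ∀ α, Category.{v} (C α)
  φ : ∀ {α β : S}, β ≤ α → (C α ⥤ C β)
  φ_refl : ∀ α, φ (le_refl α) = 𝟭 (C α)
  φ_trans : ∀ {α β γ : S} (h₁ : β ≤ α) (h₂ : γ ≤ β), φ (h₂.trans h₁) = φ h₁ ⋙ φ h₂

attribute [instance] PosetDiagram.cat

variable {S : Type} [PartialOrder S]

/-- Objects of the poset category `M(S,C)`. -/
structure ConfObj (D : PosetDiagram S) where
  F : ∀ α, D.C α
  σ : ∀ {α β : S} (h : β ≤ α), (D.φ h).obj (F α) ⟶ F β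
  σ_refl : ∀ α, σ (le_refl α) = eqToHom (by rw [D.φ_refl]; rfl)
  σ_trans : ∀ {α β γ : S} (h₁ : β ≤ α) (h₂ : γ ≤ β),
      σ (h₂.trans h₁) = eqToHom (by rw [D.φ_trans h₁ h₂]; rfl) ≫ (D.φ h₂).map (σ h₁) ≫ σ h₂

/-- Morphisms in the poset category `M(S,C)`. -/
@[ext]
structure ConfHom {D : PosetDiagram S} (F G : ConfObj D) where
  f : ∀ α, F.F α ⟶ G.F α
  comm : ∀ {α β : S} (h : β ≤ α), (D.φ h).map (f α) ≫ G.σ h = F.σ h ≫ f β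

/-- The poset category `M(S,C)`. -/
instance confCategory (D : PosetDiagram S) : Category (ConfObj D) where
  Hom F G := ConfHom F G
  id F := ⟨fun _ => 𝟙 _, by intro α β h; simp⟩
  comp u v := ⟨fun α => u.f α ≫ v.f α, by
    intro α β h
    rw [Functor.map_comp, Category.assoc, v.comm h, ← Category.assoc, u.comm h, Category.assoc]⟩
  id_comp u := by apply ConfHom.ext; funext α; exact Category.id_comp _
  comp_id u := by apply ConfHom.ext; funext α; exact Category.comp_id _
  assoc u v w := by apply ConfHom.ext; funext α; exact Category.assoc _ _ _

@[simp] lemma conf_id_f (D : PosetDiagram S) (F : ConfObj D) (α : S) :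
    (𝟙 F : ConfHom F F).f α = 𝟙 (F.F α) := rfl

@[simp] lemma conf_comp_f (D : PosetDiagram S) {F G H : ConfObj D} (u : F ⟶ G) (v : G ⟶ H)
    (α : S) : (u ≫ v).f α = u.f α ≫ v.f α := rfl

/-- The evaluation functor `j_α^* : M(S,C) ⥤ C(α)`. -/
def evalF (D : PosetDiagram S) (α : S) : ConfObj D ⥤ D.C α where
  obj F := F.F α
  map u := u.f α

/-- Restriction of a poset diagram to a subset of the poset. -/
def PosetDiagram.restrict (D : PosetDiagram S) (T : Set S) : PosetDiagram T where
  C t := D.C t.1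
  cat t := D.cat t.1
  φ h := D.φ h
  φ_refl t := D.φ_refl t.1
  φ_trans h₁ h₂ := D.φ_trans h₁ h₂

/-- The restriction functor `M(S,C) ⥤ M(T, C|_T)`. -/
def resF (D : PosetDiagram S) (T : Set S) : ConfObj D ⥤ ConfObj (D.restrict T) where
  obj F :=
    { F := fun t => F.F t.1
      σ := fun h => F.σ h
      σ_refl := fun t => F.σ_refl t.1
      σ_trans := fun h₁ h₂ => F.σ_trans h₁ h₂ }
  map u :=
    { f := fun t => u.f t.1
      comm := fun h => u.comm h }

/-- `F` is supported in `T` if all components outside of `T` vanish. -/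
def SuppIn {D : PosetDiagram S} (F : ConfObj D) (T : Set S) : Prop :=
  ∀ α, α ∉ T → IsZero (F.F α)
section DerivedPreamble

variable (A : Type u) [Category.{v} A] [Abelian A] [HasDerivedCategory.{w} A]

/-- An object of the derived category is (cohomologically) bounded. -/
def BoundedObj (X : DerivedCategory A) : Prop :=
  ∃ a b : ℤ, ∀ i : ℤ, (i < a ∨ b < i) → IsZero ((DerivedCategory.homologyFunctor A i).obj X)

/-- The bounded derived category `D^b(A)`, realized as the full subcategory of
cohomologically bounded objects of the derived category. -/
abbrev Db := ObjectProperty.FullSubcategory (BoundedObj A)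

variable {A}

lemma boundedObj_single (X : A) :
    BoundedObj A ((DerivedCategory.singleFunctor A 0).obj X) := by
  refine ⟨0, 0, fun i hi => ?_⟩
  have hne : i ≠ 0 := by rcases hi with h | h <;> omega
  have e : (DerivedCategory.homologyFunctor A i).obj
      ((DerivedCategory.singleFunctor A 0).obj X) ≅
      ((HomologicalComplex.single A (ComplexShape.up ℤ) 0).obj X).homology i :=
    (DerivedCategory.homologyFunctor A i).mapIso
      ((DerivedCategory.quotientCompQhIso A).app
        ((HomologicalComplex.single A (ComplexShape.up ℤ) 0).obj X)) ≪≫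
      (DerivedCategory.homologyFunctorFactors A i).app _
  exact (HomologicalComplex.isZero_single_obj_homology _ 0 X i hne).of_iso e

variable (A)

/-- The canonical functor `A ⥤ D^b(A)` sending `X` to the complex concentrated in degree 0. -/
noncomputable def toDb : A ⥤ Db A :=
  ObjectProperty.lift _ (DerivedCategory.singleFunctor A 0) boundedObj_single

end DerivedPreamble

namespace CategoryTheory

universe w₁ w₂ v₁ v₂ u₁ u₂

section Derived

variable {A : Type u₁} [Category.{v₁} A] [Abelian A]
  {B : Type u₂} [Category.{v₂} B] [Abelian B]

/-- A functor between abelian categories which preserves finite limits is additive. -/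
lemma Functor.additive_of_preservesFiniteLimits (F : A ⥤ B) [PreservesFiniteLimits F] :
    F.Additive := by
  have : F.PreservesZeroMorphisms := preservesZeroMorphisms_of_preserves_terminal_object
  exact F.additive_of_preserves_binary_products

/-- The adjunction between categories of complexes induced by an adjunction between
additive functors. -/
@[simps]
def Adjunction.mapCochainComplex {L : A ⥤ B} {R : B ⥤ A} (adj : L ⊣ R)
    [L.Additive] [R.Additive] :
    L.mapHomologicalComplex (ComplexShape.up ℤ) ⊣ R.mapHomologicalComplex (ComplexShape.up ℤ) where
  unit :=
    { app := fun K =>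
        { f := fun i => adj.unit.app (K.X i)
          comm' := fun i j _ => (adj.unit.naturality (K.d i j)).symm }
      naturality := fun _ _ f =>
        HomologicalComplex.Hom.ext (funext fun i => adj.unit.naturality (f.f i)) }
  counit :=
    { app := fun K =>
        { f := fun i => adj.counit.app (K.X i)
          comm' := fun i j _ => (adj.counit.naturality (K.d i j)).symm }
      naturality := fun _ _ f =>
        HomologicalComplex.Hom.ext (funext fun i => adj.counit.naturality (f.f i)) }
  left_triangle_components K :=
    HomologicalComplex.Hom.ext (funext fun i => adj.left_triangle_components (K.X i))
  right_triangle_components K :=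
    HomologicalComplex.Hom.ext (funext fun i => adj.right_triangle_components (K.X i))

variable {L : A ⥤ B} {R : B ⥤ A} (adj : L ⊣ R) [L.Additive] [R.Additive]
  [PreservesFiniteLimits L] [PreservesFiniteColimits L]
  [PreservesFiniteLimits R] [PreservesFiniteColimits R]

lemma Adjunction.quasiIso_mapCochainComplex_unit_app (K : CochainComplex A ℤ)
    (h : ∀ n, IsIso (adj.unit.app (K.homology n))) :
    QuasiIso (adj.mapCochainComplex.unit.app K) := by
  refine ⟨fun n => ?_⟩
  rw [quasiIsoAt_iff_isIso_homologyMap]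
  have : IsIso (adj.unit.app (K.sc n).homology) := h n
  have := ShortComplex.homologyMap_mapNatTrans (K.sc n) adj.unit
  change IsIso (ShortComplex.homologyMap ((K.sc n).mapNatTrans adj.unit))
  rw [this]
  infer_instance

lemma Adjunction.quasiIso_mapCochainComplex_counit_app (K : CochainComplex B ℤ)
    (h : ∀ n, IsIso (adj.counit.app (K.homology n))) :
    QuasiIso (adj.mapCochainComplex.counit.app K) := by
  refine ⟨fun n => ?_⟩
  rw [quasiIsoAt_iff_isIso_homologyMap]
  have : IsIso (adj.counit.app (K.sc n).homology) := h n
  have := ShortComplex.homologyMap_mapNatTrans (K.sc n) adj.counit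
  change IsIso (ShortComplex.homologyMap ((K.sc n).mapNatTrans adj.counit))
  rw [this]
  infer_instance

variable [HasDerivedCategory.{w₁} A] [HasDerivedCategory.{w₂} B]

noncomputable instance (F : A ⥤ B) [F.Additive] [PreservesFiniteLimits F]
    [PreservesFiniteColimits F] :
    CatCommSq (F.mapHomologicalComplex (ComplexShape.up ℤ)) DerivedCategory.Q
      DerivedCategory.Q F.mapDerivedCategory :=
  ⟨F.mapDerivedCategoryFactors.symm⟩

/-- The adjunction between derived categories induced by an adjunction between exact functors. -/
noncomputable def Adjunction.mapDerivedCategory : L.mapDerivedCategory ⊣ R.mapDerivedCategory :=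
  adj.mapCochainComplex.localization
    DerivedCategory.Q (HomologicalComplex.quasiIso A (ComplexShape.up ℤ))
    DerivedCategory.Q (HomologicalComplex.quasiIso B (ComplexShape.up ℤ)) _ _

lemma Adjunction.isIso_mapDerivedCategory_unit_app_Q_obj (K : CochainComplex A ℤ)
    (h : ∀ n, IsIso (adj.unit.app (K.homology n))) :
    IsIso (adj.mapDerivedCategory.unit.app (DerivedCategory.Q.obj K)) := by
  have := (DerivedCategory.isIso_Q_map_iff_quasiIso _ _).2
    (adj.quasiIso_mapCochainComplex_unit_app K h)
  rw [Adjunction.mapDerivedCategory, Adjunction.localization_unit_app]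
  infer_instance

lemma Adjunction.isIso_mapDerivedCategory_counit_app_Q_obj (K : CochainComplex B ℤ)
    (h : ∀ n, IsIso (adj.counit.app (K.homology n))) :
    IsIso (adj.mapDerivedCategory.counit.app (DerivedCategory.Q.obj K)) := by
  have := (DerivedCategory.isIso_Q_map_iff_quasiIso _ _).2
    (adj.quasiIso_mapCochainComplex_counit_app K h)
  rw [Adjunction.mapDerivedCategory, Adjunction.localization_counit_app]
  infer_instance

instance [IsIso adj.unit] : IsIso adj.mapDerivedCategory.unit := by
  rw [NatTrans.isIso_iff_isIso_app]
  intro X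
  rw [← NatTrans.isIso_app_iff_of_iso _ (DerivedCategory.Q.objObjPreimageIso X)]
  exact adj.isIso_mapDerivedCategory_unit_app_Q_obj _ inferInstance

instance [IsIso adj.counit] : IsIso adj.mapDerivedCategory.counit := by
  rw [NatTrans.isIso_iff_isIso_app]
  intro X
  rw [← NatTrans.isIso_app_iff_of_iso _ (DerivedCategory.Q.objObjPreimageIso X)]
  exact adj.isIso_mapDerivedCategory_counit_app_Q_obj _ inferInstance

/-- Exact functors commute with the cohomology of objects of the derived category. -/
lemma Functor.nonempty_homologyFunctor_mapDerivedCategory_obj_iso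
    (F : A ⥤ B) [F.Additive] [PreservesFiniteLimits F] [PreservesFiniteColimits F]
    (X : DerivedCategory A) (n : ℤ) :
    Nonempty ((DerivedCategory.homologyFunctor B n).obj (F.mapDerivedCategory.obj X) ≅
      F.obj ((DerivedCategory.homologyFunctor A n).obj X)) := by
  let e := DerivedCategory.Q.objObjPreimageIso X
  let K := DerivedCategory.Q.objPreimage X
  exact ⟨(DerivedCategory.homologyFunctor B n).mapIso
      (F.mapDerivedCategory.mapIso e.symm ≪≫ F.mapDerivedCategoryFactors.app K) ≪≫
    (DerivedCategory.homologyFunctorFactors B n).app _ ≪≫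
    (K.sc n).mapHomologyIso F ≪≫
    F.mapIso ((DerivedCategory.homologyFunctorFactors A n).symm.app K ≪≫
      (DerivedCategory.homologyFunctor A n).mapIso e)⟩

lemma Adjunction.isIso_mapDerivedCategory_unit_app (X : DerivedCategory A)
    (h : ∀ n, IsIso (adj.unit.app ((DerivedCategory.homologyFunctor A n).obj X))) :
    IsIso (adj.mapDerivedCategory.unit.app X) := by
  rw [← NatTrans.isIso_app_iff_of_iso _ (DerivedCategory.Q.objObjPreimageIso X)]
  refine adj.isIso_mapDerivedCategory_unit_app_Q_obj _ fun n => ?_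
  refine (NatTrans.isIso_app_iff_of_iso _
    ((DerivedCategory.homologyFunctorFactors A n).symm.app (DerivedCategory.Q.objPreimage X) ≪≫
      (DerivedCategory.homologyFunctor A n).mapIso (DerivedCategory.Q.objObjPreimageIso X))).2 (h n)

lemma Adjunction.isIso_mapDerivedCategory_counit_app (X : DerivedCategory B)
    (h : ∀ n, IsIso (adj.counit.app ((DerivedCategory.homologyFunctor B n).obj X))) :
    IsIso (adj.mapDerivedCategory.counit.app X) := by
  rw [← NatTrans.isIso_app_iff_of_iso _ (DerivedCategory.Q.objObjPreimageIso X)]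
  refine adj.isIso_mapDerivedCategory_counit_app_Q_obj _ fun n => ?_
  refine (NatTrans.isIso_app_iff_of_iso _
    ((DerivedCategory.homologyFunctorFactors B n).symm.app (DerivedCategory.Q.objPreimage X) ≪≫
      (DerivedCategory.homologyFunctor B n).mapIso (DerivedCategory.Q.objObjPreimageIso X))).2 (h n)

lemma Functor.boundedObj_mapDerivedCategory_obj
    (F : A ⥤ B) [F.Additive] [PreservesFiniteLimits F] [PreservesFiniteColimits F]
    (X : DerivedCategory A) (hX : BoundedObj A X) :
    BoundedObj B (F.mapDerivedCategory.obj X) := by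
  obtain ⟨a, b, h⟩ := hX
  refine ⟨a, b, fun i hi => ?_⟩
  obtain ⟨e⟩ := F.nonempty_homologyFunctor_mapDerivedCategory_obj_iso X i
  exact (F.map_isZero (h i hi)).of_iso e

/-- The functor between bounded derived categories induced by an exact functor. -/
noncomputable def Functor.mapDb (F : A ⥤ B) [F.Additive] [PreservesFiniteLimits F]
    [PreservesFiniteColimits F] : Db A ⥤ Db B :=
  ObjectProperty.lift _ (ObjectProperty.ι _ ⋙ F.mapDerivedCategory)
    fun X => F.boundedObj_mapDerivedCategory_obj X.obj X.property

/-- The functor `F.mapDb` extends `F`. -/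
noncomputable def Functor.toDbCompMapDbIso (F : A ⥤ B) [F.Additive] [PreservesFiniteLimits F]
    [PreservesFiniteColimits F] : toDb A ⋙ F.mapDb ≅ F ⋙ toDb B :=
  NatIso.ofComponents
    (fun X => ObjectProperty.isoMk _ ((F.mapDerivedCategorySingleFunctor 0).app X))
    (fun f => ObjectProperty.hom_ext _ ((F.mapDerivedCategorySingleFunctor 0).hom.naturality f))

lemma Functor.mapDb_essImage_iff_of_isIso (F : A ⥤ B) [F.Additive] [PreservesFiniteLimits F]
    [PreservesFiniteColimits F] (P : ObjectProperty B) [P.IsClosedUnderIsomorphisms]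
    (hP : ∀ Y, P (F.obj Y)) (G : B ⥤ A) [G.Additive] [PreservesFiniteLimits G]
    [PreservesFiniteColimits G]
    (hG : ∀ X : DerivedCategory B, (∀ n, P ((DerivedCategory.homologyFunctor B n).obj X)) →
      Nonempty (F.mapDerivedCategory.obj (G.mapDerivedCategory.obj X) ≅ X)) (X : Db B) :
    F.mapDb.essImage X ↔ ∀ n, P ((DerivedCategory.homologyFunctor B n).obj X.obj) := by
  constructor
  · rintro ⟨Y, ⟨e⟩⟩ n
    obtain ⟨e'⟩ := F.nonempty_homologyFunctor_mapDerivedCategory_obj_iso Y.obj n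
    exact P.prop_of_iso (e'.symm ≪≫ (DerivedCategory.homologyFunctor B n).mapIso
      ((ObjectProperty.ι _).mapIso e)) (hP _)
  · intro h
    obtain ⟨e⟩ := hG X.obj h
    exact ⟨G.mapDb.obj X, ⟨ObjectProperty.isoMk _ e⟩⟩

end Derived

end CategoryTheory

section ConfLimits

variable {D : PosetDiagram S} {J : Type*} [Category J]

lemma ConfObj.σ_refl_eq (F : ConfObj D) (α : S) :
    F.σ (le_refl α) = (eqToHom (D.φ_refl α)).app (F.F α) := by
  rw [F.σ_refl, eqToHom_app]

lemma ConfObj.σ_trans_eq (F : ConfObj D) {α β γ : S} (h₁ : β ≤ α) (h₂ : γ ≤ β) :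
    F.σ (h₂.trans h₁) =
      (eqToHom (D.φ_trans h₁ h₂)).app (F.F α) ≫ (D.φ h₂).map (F.σ h₁) ≫ F.σ h₂ := by
  rw [F.σ_trans h₁ h₂, eqToHom_app]

lemma ConfHom.f_comm {F G : ConfObj D} (u : F ⟶ G) {α β : S} (h : β ≤ α) :
    (D.φ h).map (u.f α) ≫ G.σ h = F.σ h ≫ u.f β :=
  u.comm h

lemma ConfHom.f_comm_assoc {F G : ConfObj D} (u : F ⟶ G) {α β : S} (h : β ≤ α) {X : D.C β}
    (k : G.F β ⟶ X) :
    (D.φ h).map (u.f α) ≫ G.σ h ≫ k = F.σ h ≫ u.f β ≫ k := by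
  rw [← Category.assoc, u.f_comm h, Category.assoc]

/-- Constructor for isomorphisms in `ConfObj D`. -/
@[simps]
def confIsoMk {F G : ConfObj D} (e : ∀ α, F.F α ≅ G.F α)
    (comm : ∀ {α β : S} (h : β ≤ α), (D.φ h).map (e α).hom ≫ G.σ h = F.σ h ≫ (e β).hom) :
    F ≅ G where
  hom := { f := fun α => (e α).hom, comm := comm }
  inv :=
    { f := fun α => (e α).inv
      comm := fun {α β} h => by
        rw [← cancel_mono (e β).hom, Category.assoc, ← comm h, ← Functor.map_comp_assoc]
        simp }
  hom_inv_id := ConfHom.ext (funext fun α => (e α).hom_inv_id)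
  inv_hom_id := ConfHom.ext (funext fun α => (e α).inv_hom_id)

lemma conf_isIso_of_isIso_f {F G : ConfObj D} (u : F ⟶ G) (h : ∀ α, IsIso (u.f α)) : IsIso u :=
  (confIsoMk (fun α => asIso (u.f α)) u.comm).isIso_hom

/-- A cone in `ConfObj D` which is componentwise a limit cone is a limit cone. -/
def isLimitOfEval {K : J ⥤ ConfObj D} (c : Cone K)
    (hc : ∀ α, IsLimit ((evalF D α).mapCone c)) : IsLimit c where
  lift s :=
    { f := fun α => (hc α).lift ((evalF D α).mapCone s)
      comm := fun {α β} h => by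
        refine (hc β).hom_ext fun j => ?_
        have h₁ := (hc α).fac ((evalF D α).mapCone s) j
        have h₂ := (hc β).fac ((evalF D β).mapCone s) j
        have h₃ := ConfHom.f_comm (c.π.app j) h
        have h₄ := ConfHom.f_comm (s.π.app j) h
        dsimp [evalF] at h₁ h₂ h₃ h₄ ⊢
        rw [Category.assoc, Category.assoc, h₂, ← h₃, ← Functor.map_comp_assoc, h₁, h₄] }
  fac s j := ConfHom.ext (funext fun α => (hc α).fac ((evalF D α).mapCone s) j)
  uniq s m hm := ConfHom.ext (funext fun α => (hc α).uniq ((evalF D α).mapCone s) _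
    fun j => congr_arg (fun u : ConfHom _ _ => u.f α) (hm j))

/-- If the transition functors preserve the relevant colimits, a cocone in `ConfObj D` which is
componentwise a colimit cocone is a colimit cocone. -/
noncomputable def isColimitOfEval {K : J ⥤ ConfObj D} (c : Cocone K)
    [∀ {α β : S} (h : β ≤ α), PreservesColimitsOfShape J (D.φ h)]
    (hc : ∀ α, IsColimit ((evalF D α).mapCocone c)) : IsColimit c where
  desc s :=
    { f := fun α => (hc α).desc ((evalF D α).mapCocone s)
      comm := fun {α β} h => by
        refine (isColimitOfPreserves (D.φ h) (hc α)).hom_ext fun j => ?_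
        have h₁ := (hc α).fac ((evalF D α).mapCocone s) j
        have h₂ := (hc β).fac ((evalF D β).mapCocone s) j
        have h₃ := ConfHom.f_comm_assoc (c.ι.app j) h ((hc β).desc ((evalF D β).mapCocone s))
        have h₄ := ConfHom.f_comm (s.ι.app j) h
        dsimp [evalF] at h₁ h₂ h₃ h₄ ⊢
        rw [← Functor.map_comp_assoc, h₁, h₄, h₃, h₂] }
  fac s j := ConfHom.ext (funext fun α => (hc α).fac ((evalF D α).mapCocone s) j)
  uniq s m hm := ConfHom.ext (funext fun α => (hc α).uniq ((evalF D α).mapCocone s) _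
    fun j => congr_arg (fun u : ConfHom _ _ => u.f α) (hm j))

section

variable (K : J ⥤ ConfObj D) [∀ α, HasLimit (K ⋙ evalF D α)]

/-- The projections of the componentwise limit of a diagram in `ConfObj D`. -/
noncomputable def confLimitπ (α : S) (j : J) : limit (K ⋙ evalF D α) ⟶ (K.obj j).F α :=
  limit.π (K ⋙ evalF D α) j

lemma confLimitπ_w (α : S) {i j : J} (f : i ⟶ j) :
    confLimitπ K α i ≫ (K.map f).f α = confLimitπ K α j :=
  limit.w (K ⋙ evalF D α) f

/-- The transition maps of the componentwise limit of a diagram in `ConfObj D`. -/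
noncomputable def confLimitσ {α β : S} (h : β ≤ α) :
    (D.φ h).obj (limit (K ⋙ evalF D α)) ⟶ limit (K ⋙ evalF D β) :=
  limit.lift (K ⋙ evalF D β)
    { pt := (D.φ h).obj (limit (K ⋙ evalF D α))
      π :=
        { app := fun j => (D.φ h).map (confLimitπ K α j) ≫ (K.obj j).σ h
          naturality := fun i j f => by
            have : (D.φ h).map (confLimitπ K α j) ≫ (K.obj j).σ h =
                ((D.φ h).map (confLimitπ K α i) ≫ (K.obj i).σ h) ≫ (K.map f).f β := by
              rw [Category.assoc, ← ConfHom.f_comm, ← Functor.map_comp_assoc, confLimitπ_w]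
            exact (Category.id_comp _).trans this } }

lemma confLimitσ_π {α β : S} (h : β ≤ α) (j : J) :
    confLimitσ K h ≫ confLimitπ K β j = (D.φ h).map (confLimitπ K α j) ≫ (K.obj j).σ h :=
  limit.lift_π _ _

/-- The componentwise limit of a diagram in `ConfObj D`. -/
noncomputable def confLimit : ConfObj D where
  F α := limit (K ⋙ evalF D α)
  σ h := confLimitσ K h
  σ_refl α := by
    refine limit.hom_ext fun j => (confLimitσ_π K _ j).trans ?_
    rw [ConfObj.σ_refl_eq]
    refine ((eqToHom (D.φ_refl α)).naturality _).trans ?_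
    rw [eqToHom_app]
    rfl
  σ_trans {α β γ} h₁ h₂ := by
    refine limit.hom_ext fun j => (confLimitσ_π K _ j).trans ?_
    refine Eq.trans ?_ (Category.assoc _ _ _).symm
    rw [(K.obj j).σ_trans_eq h₁ h₂]
    refine ((eqToHom (D.φ_trans h₁ h₂)).naturality_assoc _ _).trans ?_
    rw [eqToHom_app]
    congr 1
    refine Eq.trans ?_ (Category.assoc _ _ _).symm
    refine Eq.trans ?_ (congr_arg (_ ≫ ·) (confLimitσ_π K h₂ j).symm)
    rw [← Functor.map_comp_assoc, confLimitσ_π, Functor.map_comp, Category.assoc]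
    rfl

/-- The componentwise limit cone of a diagram in `ConfObj D`. -/
noncomputable def confLimitCone : Cone K where
  pt := confLimit K
  π :=
    { app := fun j =>
        { f := fun α => confLimitπ K α j
          comm := fun h => (confLimitσ_π K h j).symm }
      naturality := fun _ _ f => ConfHom.ext (funext fun α =>
        (Category.id_comp _).trans (confLimitπ_w K α f).symm) }

instance preservesLimit_evalF (α : S) : PreservesLimit K (evalF D α) :=
  have h (β : S) : IsLimit ((evalF D β).mapCone (confLimitCone K)) :=
    limit.isLimit (K ⋙ evalF D β)
  preservesLimit_of_preserves_limit_cone (isLimitOfEval (confLimitCone K) h) (h α)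

end

section

variable (K : J ⥤ ConfObj D) [∀ α, HasColimit (K ⋙ evalF D α)]

/-- The coprojections of the componentwise colimit of a diagram in `ConfObj D`. -/
noncomputable def confColimitι (α : S) (j : J) : (K.obj j).F α ⟶ colimit (K ⋙ evalF D α) :=
  colimit.ι (K ⋙ evalF D α) j

lemma confColimitι_w (α : S) {i j : J} (f : i ⟶ j) :
    (K.map f).f α ≫ confColimitι K α j = confColimitι K α i :=
  colimit.w (K ⋙ evalF D α) f

variable [∀ {α β : S} (h : β ≤ α), PreservesColimitsOfShape J (D.φ h)]

lemma confColimit_hom_ext {α β : S} (h : β ≤ α) {Y : D.C β}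
    {f g : (D.φ h).obj (colimit (K ⋙ evalF D α)) ⟶ Y}
    (hfg : ∀ j, (D.φ h).map (confColimitι K α j) ≫ f = (D.φ h).map (confColimitι K α j) ≫ g) :
    f = g :=
  (isColimitOfPreserves (D.φ h) (colimit.isColimit (K ⋙ evalF D α))).hom_ext hfg

/-- The transition maps of the componentwise colimit of a diagram in `ConfObj D`. -/
noncomputable def confColimitσ {α β : S} (h : β ≤ α) :
    (D.φ h).obj (colimit (K ⋙ evalF D α)) ⟶ colimit (K ⋙ evalF D β) :=
  (isColimitOfPreserves (D.φ h) (colimit.isColimit (K ⋙ evalF D α))).desc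
    { pt := colimit (K ⋙ evalF D β)
      ι :=
        { app := fun j => (K.obj j).σ h ≫ confColimitι K β j
          naturality := fun i j f => by
            have : (D.φ h).map ((K.map f).f α) ≫ (K.obj j).σ h ≫ confColimitι K β j =
                (K.obj i).σ h ≫ confColimitι K β i := by
              rw [ConfHom.f_comm_assoc, confColimitι_w]
            exact this.trans (Category.comp_id _).symm } }

lemma confColimitι_σ {α β : S} (h : β ≤ α) (j : J) :
    (D.φ h).map (confColimitι K α j) ≫ confColimitσ K h = (K.obj j).σ h ≫ confColimitι K β j :=
  (isColimitOfPreserves (D.φ h) (colimit.isColimit (K ⋙ evalF D α))).fac _ j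

/-- The componentwise colimit of a diagram in `ConfObj D`. -/
noncomputable def confColimit : ConfObj D where
  F α := colimit (K ⋙ evalF D α)
  σ h := confColimitσ K h
  σ_refl α := by
    refine confColimit_hom_ext K _ fun j => (confColimitι_σ K _ j).trans ?_
    rw [ConfObj.σ_refl_eq]
    refine ((eqToHom (D.φ_refl α)).naturality (confColimitι K α j)).symm.trans ?_
    rw [eqToHom_app]
  σ_trans {α β γ} h₁ h₂ := by
    refine confColimit_hom_ext K _ fun j => (confColimitι_σ K _ j).trans ?_
    have h₃ := (eqToHom (D.φ_trans h₁ h₂)).naturality_assoc (confColimitι K α j)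
      ((D.φ h₂).map (confColimitσ K h₁) ≫ confColimitσ K h₂)
    rw [eqToHom_app (D.φ_trans h₁ h₂) (colimit (K ⋙ evalF D α))] at h₃
    refine Eq.trans ?_ h₃.symm
    rw [(K.obj j).σ_trans_eq h₁ h₂, Category.assoc, Category.assoc, ← confColimitι_σ,
      ← Functor.map_comp_assoc, ← confColimitι_σ, Functor.map_comp, Category.assoc]
    rfl

/-- The componentwise colimit cocone of a diagram in `ConfObj D`. -/
noncomputable def confColimitCocone : Cocone K where
  pt := confColimit K
  ι :=
    { app := fun j =>
        { f := fun α => confColimitι K α j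
          comm := fun h => confColimitι_σ K h j }
      naturality := fun _ _ f => ConfHom.ext (funext fun α =>
        (confColimitι_w K α f).trans (Category.comp_id _).symm) }

instance preservesColimit_evalF (α : S) : PreservesColimit K (evalF D α) :=
  have h (β : S) : IsColimit ((evalF D β).mapCocone (confColimitCocone K)) :=
    colimit.isColimit (K ⋙ evalF D β)
  preservesColimit_of_preserves_colimit_cocone (isColimitOfEval (confColimitCocone K) h) (h α)

end

end ConfLimits

section ExtensionByZero

open scoped ZeroObject

variable {D : PosetDiagram S} {T : Set S}

instance [∀ α, Abelian (D.C α)] (t : T) : Abelian ((D.restrict T).C t) :=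
  inferInstanceAs (Abelian (D.C t.1))

section

variable (F : ConfObj (D.restrict T))

/-- The components of an object of `M(T, C|_T)`, as objects of the categories `C(α)`. -/
def restrictComponent (t : T) : D.C t.1 := F.F t

/-- The transition maps of an object of `M(T, C|_T)`, as morphisms in the categories `C(α)`. -/
def restrictσ {s t : T} (h : t.1 ≤ s.1) :
    (D.φ h).obj (restrictComponent F s) ⟶ restrictComponent F t :=
  F.σ (α := s) (β := t) h

lemma restrictσ_refl (t : T) :
    restrictσ F (le_refl t.1) = (eqToHom (D.φ_refl t.1)).app (restrictComponent F t) :=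
  (F.σ_refl t).trans (eqToHom_app (D.φ_refl t.1) (restrictComponent F t)).symm

lemma restrictσ_trans {r s t : T} (h₁ : s.1 ≤ r.1) (h₂ : t.1 ≤ s.1) :
    restrictσ F (h₂.trans h₁) = (eqToHom (D.φ_trans h₁ h₂)).app (restrictComponent F r) ≫
      (D.φ h₂).map (restrictσ F h₁) ≫ restrictσ F h₂ :=
  (F.σ_trans (α := r) (β := s) (γ := t) h₁ h₂).trans
    (congr_arg (· ≫ (D.φ h₂).map (restrictσ F h₁) ≫ restrictσ F h₂)
      (eqToHom_app (D.φ_trans h₁ h₂) (restrictComponent F r)).symm)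

variable [∀ α, Abelian (D.C α)]

lemma conf_isIso_of_isIso_resF_map {F G : ConfObj D} (hF : SuppIn F T) (hG : SuppIn G T)
    (u : F ⟶ G) [IsIso ((resF D T).map u)] : IsIso u := by
  refine conf_isIso_of_isIso_f u fun α => ?_
  by_cases h : α ∈ T
  · exact inferInstanceAs (IsIso ((evalF (D.restrict T) ⟨α, h⟩).map ((resF D T).map u)))
  · exact ⟨0, (hF α h).eq_of_src _ _, (hG α h).eq_of_src _ _⟩

open scoped Classical in
lemma exists_extension_of_resF_hom {X Y : ConfObj D} (g : (resF D T).obj X ⟶ (resF D T).obj Y) :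
    ∃ f : ∀ α, X.F α ⟶ Y.F α, ∀ (α : S) (h : α ∈ T), f α = g.f ⟨α, h⟩ :=
  ⟨fun α => if h : α ∈ T then g.f ⟨α, h⟩ else 0, fun _ h => dif_pos h⟩

open scoped Classical in
/-- The components of the extension by zero. -/
noncomputable def extComponent (α : S) : D.C α :=
  if h : α ∈ T then restrictComponent F ⟨α, h⟩ else 0

/-- On `T`, the extension by zero of `F` has the same components as `F`. -/
noncomputable def extComponentIso (t : T) : extComponent F t.1 ≅ restrictComponent F t :=
  eqToIso (dif_pos t.2)

lemma isZero_extComponent {α : S} (h : α ∉ T) : IsZero (extComponent F α) := by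
  rw [extComponent, dif_neg h]
  exact isZero_zero _

open scoped Classical in
/-- The transition maps of the extension by zero. -/
noncomputable def extσ {α β : S} (h : β ≤ α) :
    (D.φ h).obj (extComponent F α) ⟶ extComponent F β :=
  if hαβ : α ∈ T ∧ β ∈ T then
    (D.φ h).map (extComponentIso F ⟨α, hαβ.1⟩).hom ≫
      restrictσ F (s := ⟨α, hαβ.1⟩) (t := ⟨β, hαβ.2⟩) h ≫ (extComponentIso F ⟨β, hαβ.2⟩).inv
  else 0

lemma extσ_eq {s t : T} (h : t.1 ≤ s.1) :
    extσ F h = (D.φ h).map (extComponentIso F s).hom ≫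
      restrictσ F h ≫ (extComponentIso F t).inv :=
  dif_pos ⟨s.2, t.2⟩

lemma extσ_refl (t : T) :
    extσ F (le_refl t.1) = (eqToHom (D.φ_refl t.1)).app (extComponent F t.1) := by
  rw [extσ_eq, restrictσ_refl]
  refine ((eqToHom (D.φ_refl t.1)).naturality_assoc _ _).trans ?_
  simp

lemma extσ_trans {r s t : T} (h₁ : s.1 ≤ r.1) (h₂ : t.1 ≤ s.1) :
    extσ F (h₂.trans h₁) = (eqToHom (D.φ_trans h₁ h₂)).app (extComponent F r.1) ≫
      (D.φ h₂).map (extσ F h₁) ≫ extσ F h₂ := by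
  rw [extσ_eq, extσ_eq, extσ_eq, restrictσ_trans, Category.assoc]
  refine ((eqToHom (D.φ_trans h₁ h₂)).naturality_assoc _ _).trans ?_
  congr 1
  simp only [Functor.map_comp, Category.assoc, Functor.comp_map, Iso.map_inv_hom_id_assoc]

lemma resF_map_bijective_of_isUpperSet (hT : IsUpperSet T) (X : ConfObj D) {Y : ConfObj D}
    (hY : SuppIn Y T) :
    Function.Bijective ((resF D T).map : (X ⟶ Y) → ((resF D T).obj X ⟶ (resF D T).obj Y)) := by
  refine ⟨fun u v huv => ConfHom.ext (funext fun α => ?_), fun g => ?_⟩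
  · by_cases h : α ∈ T
    · exact congr_arg (fun w : ConfHom _ _ => w.f ⟨α, h⟩) huv
    · exact (hY α h).eq_of_tgt _ _
  · obtain ⟨f, hf⟩ := exists_extension_of_resF_hom g
    refine ⟨{ f := f, comm := fun {α β} h => ?_ }, ConfHom.ext (funext fun t => hf t.1 t.2)⟩
    by_cases hβ : β ∈ T
    · rw [hf β hβ, hf α (hT h hβ)]
      exact g.comm (α := ⟨α, hT h hβ⟩) (β := ⟨β, hβ⟩) h
    · exact (hY β hβ).eq_of_tgt _ _

variable [∀ {α β : S} (h : β ≤ α), PreservesFiniteColimits (D.φ h)]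

lemma PosetDiagram.isZero_φ_obj {α β : S} (h : β ≤ α) {X : D.C α} (hX : IsZero X) :
    IsZero ((D.φ h).obj X) := by
  have : (D.φ h).PreservesZeroMorphisms := Functor.preservesZeroMorphisms_of_preserves_initial_object
  exact (D.φ h).map_isZero hX

lemma resF_map_bijective_of_isLowerSet (hT : IsLowerSet T) {X : ConfObj D} (hX : SuppIn X T)
    (Y : ConfObj D) :
    Function.Bijective ((resF D T).map : (X ⟶ Y) → ((resF D T).obj X ⟶ (resF D T).obj Y)) := by
  refine ⟨fun u v huv => ConfHom.ext (funext fun α => ?_), fun g => ?_⟩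
  · by_cases h : α ∈ T
    · exact congr_arg (fun w : ConfHom _ _ => w.f ⟨α, h⟩) huv
    · exact (hX α h).eq_of_src _ _
  · obtain ⟨f, hf⟩ := exists_extension_of_resF_hom g
    refine ⟨{ f := f, comm := fun {α β} h => ?_ }, ConfHom.ext (funext fun t => hf t.1 t.2)⟩
    by_cases hα : α ∈ T
    · rw [hf α hα, hf β (hT h hα)]
      exact g.comm (α := ⟨α, hα⟩) (β := ⟨β, hT h hα⟩) h
    · exact (PosetDiagram.isZero_φ_obj h (hX α hα)).eq_of_src _ _

/-- The extension by zero of an object of `M(T, C|_T)` to an object of `M(S, C)`, for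
`T` locally closed. -/
noncomputable def extObj (hT : T.OrdConnected) : ConfObj D where
  F α := extComponent F α
  σ h := extσ F h
  σ_refl α := by
    by_cases hα : α ∈ T
    · exact (extσ_refl F ⟨α, hα⟩).trans (eqToHom_app _ _)
    · exact (isZero_extComponent F hα).eq_of_tgt _ _
  σ_trans {α β γ} h₁ h₂ := by
    by_cases hα : α ∈ T
    · by_cases hγ : γ ∈ T
      · have hβ := hT.out hγ hα ⟨h₂, h₁⟩
        rw [extσ_trans F (r := ⟨α, hα⟩) (s := ⟨β, hβ⟩) (t := ⟨γ, hγ⟩) h₁ h₂, eqToHom_app]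
      · exact (isZero_extComponent F hγ).eq_of_tgt _ _
    · exact (PosetDiagram.isZero_φ_obj _ (isZero_extComponent F hα)).eq_of_src _ _

lemma suppIn_extObj (hT : T.OrdConnected) : SuppIn (extObj F hT) T :=
  fun _ h => isZero_extComponent F h

/-- The restriction to `T` of the extension by zero of `F` identifies to `F`. -/
noncomputable def resFExtObjIso (hT : T.OrdConnected) :
    (resF D T).obj (extObj F hT) ≅ F :=
  confIsoMk (D := D.restrict T) (fun t => extComponentIso F t) (fun {s t} h => by
    refine Eq.trans ?_ (congr_arg (· ≫ (extComponentIso F t).hom)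
      (extσ_eq F (s := s) (t := t) h)).symm
    simp only [Category.assoc, Iso.inv_hom_id, Category.comp_id]
    rfl)

/-- The universal property of the extension by zero from a lower set. -/
noncomputable def extByZeroLeftEquiv (hT : IsLowerSet T) (F : ConfObj (D.restrict T))
    (Y : ConfObj D) :
    (extObj F hT.ordConnected ⟶ Y) ≃ (F ⟶ (resF D T).obj Y) :=
  (Equiv.ofBijective _ (resF_map_bijective_of_isLowerSet hT
    (suppIn_extObj F hT.ordConnected) Y)).trans
    ((resFExtObjIso F hT.ordConnected).homCongr (Iso.refl _))

lemma extByZeroLeftEquiv_apply (hT : IsLowerSet T) (F : ConfObj (D.restrict T))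
    (Y : ConfObj D) (u : extObj F hT.ordConnected ⟶ Y) :
    extByZeroLeftEquiv hT F Y u = (resFExtObjIso F hT.ordConnected).inv ≫ (resF D T).map u := by
  simp [extByZeroLeftEquiv]

/-- The universal property of the extension by zero from an upper set. -/
noncomputable def extByZeroRightEquiv (hT : IsUpperSet T) (X : ConfObj D)
    (F : ConfObj (D.restrict T)) :
    ((resF D T).obj X ⟶ F) ≃ (X ⟶ extObj F hT.ordConnected) :=
  ((Iso.refl _).homCongr (resFExtObjIso F hT.ordConnected).symm).trans
    (Equiv.ofBijective _ (resF_map_bijective_of_isUpperSet hT X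
      (suppIn_extObj F hT.ordConnected))).symm

lemma resF_map_extByZeroRightEquiv (hT : IsUpperSet T) (X : ConfObj D)
    (F : ConfObj (D.restrict T)) (g : (resF D T).obj X ⟶ F) :
    (resF D T).map (extByZeroRightEquiv hT X F g) =
      g ≫ (resFExtObjIso F hT.ordConnected).inv := by
  refine (Equiv.ofBijective_apply_symm_apply _ (resF_map_bijective_of_isUpperSet hT X
    (suppIn_extObj F hT.ordConnected)) _).trans ?_
  simp

variable (D)

/-- The extension by zero functor from a lower set (the functor `j_!`). -/
noncomputable def extByZeroLeft (hT : IsLowerSet T) : ConfObj (D.restrict T) ⥤ ConfObj D :=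
  Adjunction.leftAdjointOfEquiv (G := resF D T) (extByZeroLeftEquiv hT)
    (fun X Y Y' g h => by simp [extByZeroLeftEquiv_apply])

/-- The functor `j_!` is left adjoint to the restriction `j^*`. -/
noncomputable def extByZeroLeftAdj (hT : IsLowerSet T) : extByZeroLeft D hT ⊣ resF D T :=
  Adjunction.adjunctionOfEquivLeft _ _

instance (hT : IsLowerSet T) : IsIso (extByZeroLeftAdj D hT).unit := by
  rw [NatTrans.isIso_iff_isIso_app]
  intro F
  have : (extByZeroLeftAdj D hT).unit.app F = (resFExtObjIso F hT.ordConnected).inv := by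
    refine (extByZeroLeftEquiv_apply hT F _ (𝟙 _)).trans ?_
    simp
  rw [this]
  exact (resFExtObjIso F hT.ordConnected).isIso_inv

/-- The extension by zero functor from an upper set (the functor `i_*`). -/
noncomputable def extByZeroRight (hT : IsUpperSet T) : ConfObj (D.restrict T) ⥤ ConfObj D :=
  Adjunction.rightAdjointOfEquiv (F := resF D T) (extByZeroRightEquiv hT)
    (fun X' X F f g => (resF_map_bijective_of_isUpperSet hT X'
      (suppIn_extObj F hT.ordConnected)).1 (by simp [resF_map_extByZeroRightEquiv]))

/-- The functor `i_*` is right adjoint to the restriction `i^*`. -/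
noncomputable def extByZeroRightAdj (hT : IsUpperSet T) : resF D T ⊣ extByZeroRight D hT :=
  Adjunction.adjunctionOfEquivRight _ _

instance (hT : IsUpperSet T) : IsIso (extByZeroRightAdj D hT).counit := by
  rw [NatTrans.isIso_iff_isIso_app]
  intro F
  have : (extByZeroRightAdj D hT).counit.app F = (resFExtObjIso F hT.ordConnected).hom := by
    refine (Equiv.symm_apply_eq (extByZeroRightEquiv hT _ F)).2 ((resF_map_bijective_of_isUpperSet hT _
      (suppIn_extObj F hT.ordConnected)).1 ?_)
    refine Eq.trans ?_ (resF_map_extByZeroRightEquiv hT _ F _).symm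
    simp
  rw [this]
  exact (resFExtObjIso F hT.ordConnected).isIso_hom

end

section

lemma preservesLimitsOfShape_of_evalF {M : Type*} [Category M] (G : M ⥤ ConfObj D)
    (J : Type*) [Category J] (hG : ∀ α, PreservesLimitsOfShape J (G ⋙ evalF D α)) :
    PreservesLimitsOfShape J G where
  preservesLimit := ⟨fun hc => ⟨isLimitOfEval _ fun α =>
    have := hG α
    isLimitOfPreserves (G ⋙ evalF D α) hc⟩⟩

lemma preservesColimitsOfShape_of_evalF {M : Type*} [Category M] (G : M ⥤ ConfObj D)
    (J : Type*) [Category J] [∀ {α β : S} (h : β ≤ α), PreservesColimitsOfShape J (D.φ h)]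
    (hG : ∀ α, PreservesColimitsOfShape J (G ⋙ evalF D α)) :
    PreservesColimitsOfShape J G where
  preservesColimit := ⟨fun hc => ⟨isColimitOfEval _ fun α =>
    have := hG α
    isColimitOfPreserves (G ⋙ evalF D α) hc⟩⟩

variable [∀ α, Abelian (D.C α)]

instance (α : S) : PreservesFiniteLimits (evalF D α) where
  preservesFiniteLimits _ := ⟨inferInstance⟩

instance : PreservesFiniteLimits (resF D T) where
  preservesFiniteLimits J _ _ := preservesLimitsOfShape_of_evalF _ J fun t =>
    inferInstanceAs (PreservesLimitsOfShape J (evalF D t.1))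

lemma isZero_comp_evalF {E : ConfObj (D.restrict T) ⥤ ConfObj D}
    (hE : ∀ F, SuppIn (E.obj F) T) {α : S} (hα : α ∉ T) : IsZero (E ⋙ evalF D α) :=
  (Functor.isZero_iff _).2 fun F => hE F α hα

/-- If `E` is a section of the restriction to `T`, then the components of `E` at elements of `T`
are the evaluation functors. -/
def compEvalFIso {E : ConfObj (D.restrict T) ⥤ ConfObj D} (e : E ⋙ resF D T ≅ 𝟭 _) (t : T) :
    evalF (D.restrict T) t ≅ E ⋙ resF D T ⋙ evalF (D.restrict T) t :=
  Functor.isoWhiskerRight e.symm (evalF (D.restrict T) t)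

lemma preservesFiniteLimits_of_suppIn {E : ConfObj (D.restrict T) ⥤ ConfObj D}
    (e : E ⋙ resF D T ≅ 𝟭 _) (hE : ∀ F, SuppIn (E.obj F) T) : PreservesFiniteLimits E where
  preservesFiniteLimits J _ _ := preservesLimitsOfShape_of_evalF _ J fun α => by
    by_cases hα : α ∈ T
    · exact preservesLimitsOfShape_of_natIso (J := J) (G := E ⋙ resF D T ⋙ evalF _ ⟨α, hα⟩)
        (compEvalFIso e ⟨α, hα⟩)
    · exact Functor.preservesLimitsOfShape_of_isZero _ (isZero_comp_evalF hE hα) J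

variable [∀ {α β : S} (h : β ≤ α), PreservesFiniteColimits (D.φ h)]

instance (α : S) : PreservesFiniteColimits (evalF D α) where
  preservesFiniteColimits _ := ⟨inferInstance⟩

instance {α β : T} (h : β ≤ α) : PreservesFiniteColimits ((D.restrict T).φ h) :=
  inferInstanceAs (PreservesFiniteColimits (D.φ (α := α.1) (β := β.1) h))

instance : PreservesFiniteColimits (resF D T) where
  preservesFiniteColimits J _ _ := preservesColimitsOfShape_of_evalF _ J fun t =>
    inferInstanceAs (PreservesColimitsOfShape J (evalF D t.1))

lemma preservesFiniteColimits_of_suppIn {E : ConfObj (D.restrict T) ⥤ ConfObj D}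
    (e : E ⋙ resF D T ≅ 𝟭 _) (hE : ∀ F, SuppIn (E.obj F) T) : PreservesFiniteColimits E where
  preservesFiniteColimits J _ _ := preservesColimitsOfShape_of_evalF _ J fun α => by
    by_cases hα : α ∈ T
    · exact preservesColimitsOfShape_of_natIso (J := J) (G := E ⋙ resF D T ⋙ evalF _ ⟨α, hα⟩)
        (compEvalFIso e ⟨α, hα⟩)
    · exact Functor.preservesColimitsOfShape_of_isZero _ (isZero_comp_evalF hE hα) J

variable (D)

lemma suppIn_extByZeroLeft_obj (hT : IsLowerSet T) (F : ConfObj (D.restrict T)) :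
    SuppIn ((extByZeroLeft D hT).obj F) T :=
  suppIn_extObj F hT.ordConnected

lemma suppIn_extByZeroRight_obj (hT : IsUpperSet T) (F : ConfObj (D.restrict T)) :
    SuppIn ((extByZeroRight D hT).obj F) T :=
  suppIn_extObj F hT.ordConnected

instance (hT : IsLowerSet T) : PreservesFiniteLimits (extByZeroLeft D hT) :=
  preservesFiniteLimits_of_suppIn (asIso (extByZeroLeftAdj D hT).unit).symm
    (suppIn_extByZeroLeft_obj D hT)

instance (hT : IsLowerSet T) : PreservesFiniteColimits (extByZeroLeft D hT) :=
  preservesFiniteColimits_of_suppIn (asIso (extByZeroLeftAdj D hT).unit).symm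
    (suppIn_extByZeroLeft_obj D hT)

instance (hT : IsUpperSet T) : PreservesFiniteLimits (extByZeroRight D hT) :=
  preservesFiniteLimits_of_suppIn (asIso (extByZeroRightAdj D hT).counit)
    (suppIn_extByZeroRight_obj D hT)

instance (hT : IsUpperSet T) : PreservesFiniteColimits (extByZeroRight D hT) :=
  preservesFiniteColimits_of_suppIn (asIso (extByZeroRightAdj D hT).counit)
    (suppIn_extByZeroRight_obj D hT)

variable {D}

lemma isIso_extByZeroLeftAdj_counit_app (hT : IsLowerSet T) {X : ConfObj D} (hX : SuppIn X T) :
    IsIso ((extByZeroLeftAdj D hT).counit.app X) := by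
  have : IsIso ((resF D T).map ((extByZeroLeftAdj D hT).counit.app X)) :=
    IsIso.of_isIso_fac_left ((extByZeroLeftAdj D hT).right_triangle_components X)
  exact conf_isIso_of_isIso_resF_map (suppIn_extByZeroLeft_obj D hT _) hX _

lemma isIso_extByZeroRightAdj_unit_app (hT : IsUpperSet T) {X : ConfObj D} (hX : SuppIn X T) :
    IsIso ((extByZeroRightAdj D hT).unit.app X) := by
  have : IsIso ((resF D T).map ((extByZeroRightAdj D hT).unit.app X)) :=
    IsIso.of_isIso_fac_right (hh := IsIso.id _)
      ((extByZeroRightAdj D hT).left_triangle_components X)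
  exact conf_isIso_of_isIso_resF_map hX (suppIn_extByZeroRight_obj D hT _) _

end

/-- The property of being supported in `T`. -/
def suppInProperty (D : PosetDiagram S) (T : Set S) : ObjectProperty (ConfObj D) :=
  fun X => SuppIn X T

instance : (suppInProperty D T).IsClosedUnderIsomorphisms where
  of_iso e hX α hα := (hX α hα).of_iso ((evalF D α).mapIso e.symm)

end ExtensionByZero

section DerivedExtensionByZero

variable (D : PosetDiagram.{v, u} S) {T : Set S} [∀ α, Abelian (D.C α)]
  [∀ {α β : S} (h : β ≤ α), PreservesFiniteColimits (D.φ h)]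
  [Abelian (ConfObj D)] [Abelian (ConfObj (D.restrict T))]
  [HasDerivedCategory.{w} (ConfObj D)] [HasDerivedCategory.{w} (ConfObj (D.restrict T))]

instance : (resF D T).Additive := Functor.additive_of_preservesFiniteLimits _

instance (hT : IsLowerSet T) : (extByZeroLeft D hT).Additive :=
  Functor.additive_of_preservesFiniteLimits _

instance (hT : IsUpperSet T) : (extByZeroRight D hT).Additive :=
  Functor.additive_of_preservesFiniteLimits _

instance (hT : IsLowerSet T) : (extByZeroLeft D hT).mapDerivedCategory.Full :=
  (extByZeroLeftAdj D hT).mapDerivedCategory.fullyFaithfulLOfIsIsoUnit.full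

instance (hT : IsLowerSet T) : (extByZeroLeft D hT).mapDerivedCategory.Faithful :=
  (extByZeroLeftAdj D hT).mapDerivedCategory.fullyFaithfulLOfIsIsoUnit.faithful

instance (hT : IsUpperSet T) : (extByZeroRight D hT).mapDerivedCategory.Full :=
  (extByZeroRightAdj D hT).mapDerivedCategory.fullyFaithfulROfIsIsoCounit.full

instance (hT : IsUpperSet T) : (extByZeroRight D hT).mapDerivedCategory.Faithful :=
  (extByZeroRightAdj D hT).mapDerivedCategory.fullyFaithfulROfIsIsoCounit.faithful

lemma extByZeroLeft_mapDb_essImage_iff (hT : IsLowerSet T) (X : Db (ConfObj D)) :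
    (extByZeroLeft D hT).mapDb.essImage X ↔
      ∀ n, SuppIn ((DerivedCategory.homologyFunctor (ConfObj D) n).obj X.obj) T :=
  Functor.mapDb_essImage_iff_of_isIso _ (suppInProperty D T) (suppIn_extByZeroLeft_obj D hT)
    (resF D T) (fun Y hY =>
      have := (extByZeroLeftAdj D hT).isIso_mapDerivedCategory_counit_app Y
        fun n => isIso_extByZeroLeftAdj_counit_app hT (hY n)
      ⟨asIso ((extByZeroLeftAdj D hT).mapDerivedCategory.counit.app Y)⟩) X

lemma extByZeroRight_mapDb_essImage_iff (hT : IsUpperSet T) (X : Db (ConfObj D)) :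
    (extByZeroRight D hT).mapDb.essImage X ↔
      ∀ n, SuppIn ((DerivedCategory.homologyFunctor (ConfObj D) n).obj X.obj) T :=
  Functor.mapDb_essImage_iff_of_isIso _ (suppInProperty D T) (suppIn_extByZeroRight_obj D hT)
    (resF D T) (fun Y hY =>
      have := (extByZeroRightAdj D hT).isIso_mapDerivedCategory_unit_app Y
        fun n => isIso_extByZeroRightAdj_unit_app hT (hY n)
      ⟨(asIso ((extByZeroRightAdj D hT).mapDerivedCategory.unit.app Y)).symm⟩) X

end DerivedExtensionByZero

/-- Lemma 2.11 / Corollary 2.12: let `M = M(S,C)` be a configuration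
category in which every `C(α)` has enough injectives, and let `U ⊆ S` be open (a lower set)
with closed complement `Z = S \ U`.  The (exact) extension-by-zero functors
`i_* : M(Z,C|_Z) ⥤ M` (the right adjoint of the restriction `i^*`) and
`j_! : M(U,C|_U) ⥤ M` (the left adjoint of the restriction `j^*`) induce fully faithful
functors `D^b(M(Z,C|_Z)) ⥤ D^b(M)` and `D^b(M(U,C|_U)) ⥤ D^b(M)`, whose essential images
are the full subcategories of complexes with cohomology objects supported in `Z`,
respectively in `U`. -/
theorem extension_by_zero_derived_fully_faithful
    (S : Type) [PartialOrder S] [Fintype S]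
    (D : PosetDiagram.{v, u} S) [∀ α : S, Abelian (D.C α)]
    (hφ : ∀ {α β : S} (h : β ≤ α), PreservesFiniteColimits (D.φ h))
    (ψ : ∀ {α β : S}, β ≤ α → (D.C β ⥤ D.C α))
    (adj : ∀ {α β : S} (h : β ≤ α), D.φ h ⊣ ψ h)
    (ψlex : ∀ {α β : S} (h : β ≤ α), PreservesFiniteLimits (ψ h))
    (ψrex : ∀ {α β : S} (h : β ≤ α), PreservesFiniteColimits (ψ h))
    (hinj : ∀ α : S, EnoughInjectives (D.C α))
    (U : Set S) (hU : IsLowerSet U)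
    [Abelian (ConfObj D)] [Abelian (ConfObj (D.restrict U))] [Abelian (ConfObj (D.restrict Uᶜ))]
    [HasDerivedCategory.{w} (ConfObj D)] [HasDerivedCategory.{w} (ConfObj (D.restrict U))]
    [HasDerivedCategory.{w} (ConfObj (D.restrict Uᶜ))] :
    ∃ (i₀ : ConfObj (D.restrict Uᶜ) ⥤ ConfObj D) (j₀ : ConfObj (D.restrict U) ⥤ ConfObj D)
      (istar : Db (ConfObj (D.restrict Uᶜ)) ⥤ Db (ConfObj D))
      (jshriek : Db (ConfObj (D.restrict U)) ⥤ Db (ConfObj D)),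
      -- `i₀` is the extension by zero from the closed subset, i.e. the right adjoint of `i^*`:
      Nonempty (resF D Uᶜ ⊣ i₀) ∧
      -- `j₀` is the extension by zero from the open subset, i.e. the left adjoint of `j^*`:
      Nonempty (j₀ ⊣ resF D U) ∧
      -- `istar` and `jshriek` are the functors induced on bounded derived categories:
      Nonempty (toDb (ConfObj (D.restrict Uᶜ)) ⋙ istar ≅ i₀ ⋙ toDb (ConfObj D)) ∧
      Nonempty (toDb (ConfObj (D.restrict U)) ⋙ jshriek ≅ j₀ ⋙ toDb (ConfObj D)) ∧
      -- they are fully faithful: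
      istar.Full ∧ istar.Faithful ∧ jshriek.Full ∧ jshriek.Faithful ∧
      -- the essential image of `istar` consists of the complexes with cohomologies
      -- supported in `Z = Uᶜ`:
      (∀ X : Db (ConfObj D), istar.essImage X ↔ ∀ (n : ℤ) (α : S), α ∈ U →
        IsZero (((DerivedCategory.homologyFunctor (ConfObj D) n).obj X.obj).F α)) ∧
      -- the essential image of `jshriek` consists of the complexes with cohomologies
      -- supported in `U`:
      (∀ X : Db (ConfObj D), jshriek.essImage X ↔ ∀ (n : ℤ) (α : S), α ∉ U →
        IsZero (((DerivedCategory.homologyFunctor (ConfObj D) n).obj X.obj).F α)) := by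
  have hφ' : ∀ {α β : S} (h : β ≤ α), PreservesFiniteColimits (D.φ h) := hφ
  refine ⟨extByZeroRight D hU.compl, extByZeroLeft D hU, (extByZeroRight D hU.compl).mapDb,
    (extByZeroLeft D hU).mapDb, ⟨extByZeroRightAdj D hU.compl⟩, ⟨extByZeroLeftAdj D hU⟩,
    ⟨Functor.toDbCompMapDbIso _⟩, ⟨Functor.toDbCompMapDbIso _⟩,
    inferInstanceAs (ObjectProperty.lift _ _ _).Full,
    inferInstanceAs (ObjectProperty.lift _ _ _).Faithful,
    inferInstanceAs (ObjectProperty.lift _ _ _).Full,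
    inferInstanceAs (ObjectProperty.lift _ _ _).Faithful, fun X => ?_, fun X => ?_⟩
  · rw [extByZeroRight_mapDb_essImage_iff]
    simp only [SuppIn, Set.mem_compl_iff, not_not]
  · exact extByZeroLeft_mapDb_essImage_iff D hU X
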